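/- Let λ > 0, γ ∈ ℝ, β ∈ (0,1), and let Λ, σ, ζ_W, and W_ζ be as follows: Λ := {2λm + 2ni : m, n ∈ ℤ}, σ(z) := z·∏_{ℓ ∈ Λ\{0}} (1 − z/ℓ)·exp(z/ℓ + z²/(2ℓ²)), ζ_W := σ'/σ, and W_ζ(ζ) := (γ/(2πi))·( ζ_W(ζ − iβ) − ζ_W(ζ + iβ) + 2β·ζ_W(i) ) + 1. Then the function ζ ↦ W_ζ(ζ) − (γ/(2πi))·(ζ − iβ)^{-1} extends holomorphically to a neighborhood of iβ, with value at iβ equal to 1 + γ·(2β·ζ_W(i) − ζ_W(2βi))/(2πi); moreover, (2β·ζ_W(i) − ζ_W(2βi))/(2πi) = (1/4)·cot(πβ) + Σ_{k=1}^{∞} sin(2kπβ)/(e^{2kπλ} − 1). -/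

import Mathlib

open Set

/-- The lattice `Λ = 2λℤ × 2ℤi ⊆ ℂ`. -/
def latt (lam : ℝ) : Set ℂ :=
  {z : ℂ | ∃ m n : ℤ, z = 2 * (lam : ℂ) * (m : ℂ) + 2 * (n : ℂ) * Complex.I}

/-- The Weierstrass sigma function of the lattice `Λ`. -/
noncomputable def wsigma (lam : ℝ) (z : ℂ) : ℂ :=
  z * ∏' l : {w : ℂ // w ∈ latt lam ∧ w ≠ 0},
    (1 - z / (l : ℂ)) * Complex.exp (z / (l : ℂ) + z ^ 2 / (2 * (l : ℂ) ^ 2))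

/-- The Weierstrass zeta function `ζ_W = σ'/σ`. -/
noncomputable def wzetaW (lam : ℝ) (z : ℂ) : ℂ :=
  deriv (wsigma lam) z / wsigma lam z

/-- The derivative `W_ζ` of the periodic complex relative velocity potential. -/
noncomputable def WzP (lam γ β : ℝ) (z : ℂ) : ℂ :=
  (γ : ℂ) / (2 * (Real.pi : ℂ) * Complex.I) *
    (wzetaW lam (z - Complex.I * β) - wzetaW lam (z + Complex.I * β) +
      2 * (β : ℂ) * wzetaW lam Complex.I) + 1

/-- Lattice point with integer coordinates `p`. -/
noncomputable def LP (lam : ℝ) (p : ℤ × ℤ) : ℂ :=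
  2 * (lam : ℂ) * (p.1 : ℂ) + 2 * (p.2 : ℂ) * Complex.I

/-- Weierstrass factor (equal to one for `p = 0`). -/
noncomputable def WE (lam : ℝ) (p : ℤ × ℤ) (z : ℂ) : ℂ :=
  (1 - z / LP lam p) * Complex.exp (z / LP lam p + z ^ 2 / (2 * LP lam p ^ 2))

/-- The product part of the sigma function. -/
noncomputable def WG (lam : ℝ) (z : ℂ) : ℂ := ∏' p : ℤ × ℤ, WE lam p z

lemma LP_re (lam : ℝ) (p : ℤ × ℤ) : (LP lam p).re = 2 * lam * p.1 := by
  simp [LP]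

lemma LP_im (lam : ℝ) (p : ℤ × ℤ) : (LP lam p).im = 2 * p.2 := by
  simp [LP]

lemma LP_inj {lam : ℝ} (hlam : 0 < lam) : Function.Injective (LP lam) := by
  intro p q h
  have h1 := congrArg Complex.re h
  have h2 := congrArg Complex.im h
  rw [LP_re, LP_re] at h1
  rw [LP_im, LP_im] at h2
  have h3 : (p.1 : ℝ) = q.1 := mul_left_cancel₀ (by positivity : 2 * lam ≠ 0) h1
  have h4 : (p.2 : ℝ) = q.2 := by linarith
  exact Prod.ext (by exact_mod_cast h3) (by exact_mod_cast h4)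

lemma LP_zero (lam : ℝ) : LP lam 0 = 0 := by simp [LP]

lemma LP_ne {lam : ℝ} (hlam : 0 < lam) {p : ℤ × ℤ} (hp : p ≠ 0) : LP lam p ≠ 0 := by
  rw [← LP_zero lam]; exact fun h => hp (LP_inj hlam h)

lemma WE_zero (lam : ℝ) (z : ℂ) : WE lam 0 z = 1 := by simp [WE, LP_zero]

lemma wsigma_eq {lam : ℝ} (hlam : 0 < lam) (z : ℂ) : wsigma lam z = z * WG lam z := by
  unfold wsigma WG
  congr 1
  have h1 : (∏' p : ℤ × ℤ, WE lam p z) =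
      ∏' p : {p : ℤ × ℤ // p ≠ 0}, WE lam p z := by
    symm
    refine tprod_subtype_eq_of_mulSupport_subset (f := fun p => WE lam p z)
      (s := {p : ℤ × ℤ | p ≠ 0}) ?_
    intro p hp h0
    rw [h0] at hp
    exact hp (WE_zero lam z)
  rw [h1]
  let e : {p : ℤ × ℤ // p ≠ 0} ≃ {w : ℂ // w ∈ latt lam ∧ w ≠ 0} :=
    Equiv.ofBijective (fun p => ⟨LP lam p, ⟨p.1.1, p.1.2, rfl⟩, LP_ne hlam p.2⟩) (by
      constructor
      · intro p q h
        exact Subtype.ext (LP_inj hlam (congrArg Subtype.val h))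
      · rintro ⟨w, ⟨m, n, rfl⟩, hw⟩
        refine ⟨⟨(m, n), ?_⟩, rfl⟩
        intro h
        apply hw
        have := LP_zero lam
        rw [← h] at this
        exact this)
  rw [← e.tprod_eq]
  rfl

lemma LP_summable {lam : ℝ} (hlam : 0 < lam) :
    Summable fun p : ℤ × ℤ => (‖LP lam p‖ ^ 3)⁻¹ := by
  have h := EisensteinSeries.summable_one_div_norm_rpow (k := 3) (by norm_num)
  rw [← (finTwoArrowEquiv ℤ).symm.summable_iff] at h
  set c : ℝ := 2 * min lam 1 with hc
  have hcpos : 0 < c := by positivity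
  refine Summable.of_nonneg_of_le (fun p => by positivity) (fun p => ?_) (h.mul_left (c ^ 3)⁻¹)
  by_cases hp : p = 0
  · subst hp
    rw [LP_zero]
    simp only [norm_zero, ne_eq, OfNat.ofNat_ne_zero, not_false_eq_true, zero_pow, inv_zero]
    exact mul_nonneg (by positivity) (Real.rpow_nonneg (norm_nonneg _) _)
  have hb : c * ‖(finTwoArrowEquiv ℤ).symm p‖ ≤ ‖LP lam p‖ := by
    have h1 := Complex.abs_re_le_norm (LP lam p)
    have h2 := Complex.abs_im_le_norm (LP lam p)
    rw [LP_re, abs_mul, abs_of_pos (by positivity : 0 < 2 * lam)] at h1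
    rw [LP_im, abs_mul, abs_of_pos (by positivity : (0 : ℝ) < 2)] at h2
    rw [mul_comm, ← le_div_iff₀ hcpos, pi_norm_le_iff_of_nonneg (by positivity)]
    intro i
    rw [le_div_iff₀ hcpos]
    fin_cases i
    · simp only [finTwoArrowEquiv_symm_apply, Fin.zero_eta, Matrix.cons_val_zero, Int.norm_eq_abs]
      refine le_trans ?_ h1
      have : c ≤ 2 * lam := by rw [hc]; linarith [min_le_left lam 1]
      nlinarith [abs_nonneg (p.1 : ℝ)]
    · simp only [finTwoArrowEquiv_symm_apply, Fin.mk_one, Matrix.cons_val_one, Int.norm_eq_abs]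
      refine le_trans ?_ h2
      have : c ≤ 2 := by rw [hc]; linarith [min_le_right lam 1]
      simp only [Matrix.cons_val_fin_one]
      nlinarith [abs_nonneg (p.2 : ℝ)]
  have hx : 0 < ‖(finTwoArrowEquiv ℤ).symm p‖ := by
    rw [norm_pos_iff]
    intro h
    apply hp
    have h' := congrArg (finTwoArrowEquiv ℤ) h
    rw [Equiv.apply_symm_apply] at h'
    rw [h']; rfl
  simp only [Function.comp]
  rw [Real.rpow_neg hx.le, show (3 : ℝ) = ((3 : ℕ) : ℝ) by norm_num, Real.rpow_natCast, ← mul_inv,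
    ← mul_pow]
  gcongr

lemma factor_bound (w : ℂ) (hw : ‖w‖ ≤ 1 / 2) :
    ‖(1 - w) * Complex.exp (w + w ^ 2 / 2) - 1‖ ≤ 4 * ‖w‖ ^ 3 := by
  set u := w + w ^ 2 / 2 with hu
  have hun : ‖u‖ ≤ 5 / 4 * ‖w‖ := by
    calc ‖u‖ ≤ ‖w‖ + ‖w ^ 2 / 2‖ := norm_add_le _ _
      _ = ‖w‖ + ‖w‖ ^ 2 / 2 := by simp
      _ ≤ _ := by nlinarith [norm_nonneg w]
  have hu1 : ‖u‖ ≤ 1 := by linarith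
  have hb := Complex.exp_bound hu1 (n := 3) (by norm_num)
  simp only [Finset.sum_range_succ, Finset.sum_range_zero, Nat.factorial] at hb
  norm_num at hb
  have key : (1 - w) * Complex.exp u - 1 =
      (1 - w) * (Complex.exp u - (1 + u + u ^ 2 / 2)) - w ^ 3 * (1 / 2 + 3 / 8 * w + w ^ 2 / 8) := by
    rw [hu]; ring
  rw [key]
  have h1 : ‖(1 : ℂ) - w‖ ≤ 3 / 2 := by
    calc ‖(1 : ℂ) - w‖ ≤ ‖(1 : ℂ)‖ + ‖w‖ := norm_sub_le _ _
      _ ≤ _ := by rw [norm_one]; linarith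
  have h2 : ‖(1 / 2 + 3 / 8 * w + w ^ 2 / 8 : ℂ)‖ ≤ 1 := by
    calc ‖(1 / 2 + 3 / 8 * w + w ^ 2 / 8 : ℂ)‖ ≤ ‖(1 / 2 : ℂ)‖ + ‖(3 / 8 * w : ℂ)‖ + ‖w ^ 2 / 8‖ :=
          norm_add₃_le
      _ = 1 / 2 + 3 / 8 * ‖w‖ + ‖w‖ ^ 2 / 8 := by simp
      _ ≤ _ := by nlinarith [norm_nonneg w]
  have h3 : ‖u‖ ^ 3 ≤ (5 / 4 * ‖w‖) ^ 3 := by gcongr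
  have h0 := norm_nonneg w
  have h03 : 0 ≤ ‖w‖ ^ 3 := by positivity
  calc _ ≤ ‖(1 - w) * (Complex.exp u - (1 + u + u ^ 2 / 2))‖ +
        ‖w ^ 3 * (1 / 2 + 3 / 8 * w + w ^ 2 / 8)‖ := norm_sub_le _ _
    _ = ‖1 - w‖ * ‖Complex.exp u - (1 + u + u ^ 2 / 2)‖ +
        ‖w‖ ^ 3 * ‖(1 / 2 + 3 / 8 * w + w ^ 2 / 8 : ℂ)‖ := by rw [norm_mul, norm_mul, norm_pow]
    _ ≤ 3 / 2 * (‖u‖ ^ 3 * (2 / 9)) + ‖w‖ ^ 3 * 1 := by gcongr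
    _ ≤ 3 / 2 * ((5 / 4 * ‖w‖) ^ 3 * (2 / 9)) + ‖w‖ ^ 3 * 1 := by gcongr
    _ ≤ _ := by nlinarith

lemma LP_large {lam : ℝ} (hlam : 0 < lam) (R : ℝ) (hR : 0 < R) :
    ∀ᶠ p : ℤ × ℤ in Filter.cofinite, R ≤ ‖LP lam p‖ := by
  have h := (LP_summable hlam).tendsto_cofinite_zero
  have h2 : ∀ᶠ p : ℤ × ℤ in Filter.cofinite, (‖LP lam p‖ ^ 3)⁻¹ < (R ^ 3)⁻¹ :=
    h.eventually_lt_const (by positivity)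
  have h3 : ∀ᶠ p : ℤ × ℤ in Filter.cofinite, p ≠ 0 := by
    simp [Filter.eventually_cofinite]
  filter_upwards [h2, h3] with p hp hp0
  have hpos : 0 < ‖LP lam p‖ := norm_pos_iff.2 (LP_ne hlam hp0)
  rw [inv_lt_inv₀ (by positivity) (by positivity)] at hp
  exact (lt_of_pow_lt_pow_left₀ 3 hpos.le hp).le

lemma WE_bound {lam : ℝ} (hlam : 0 < lam) (R : ℝ) (hR : 0 < R) :
    ∀ᶠ p : ℤ × ℤ in Filter.cofinite, ∀ z ∈ Metric.ball (0 : ℂ) R,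
      ‖WE lam p z - 1‖ ≤ 4 * R ^ 3 * (‖LP lam p‖ ^ 3)⁻¹ := by
  filter_upwards [LP_large hlam (2 * R) (by positivity)] with p hp z hz
  have hz' : ‖z‖ < R := by simpa using hz
  have hpos : 0 < ‖LP lam p‖ := by linarith
  have hw : ‖z / LP lam p‖ ≤ 1 / 2 := by
    rw [norm_div, div_le_iff₀ hpos]; linarith
  have := factor_bound _ hw
  have e : WE lam p z = (1 - z / LP lam p) *
      Complex.exp (z / LP lam p + (z / LP lam p) ^ 2 / 2) := by
    unfold WE; congr 3; rw [div_pow, div_div]; ring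
  rw [e]
  refine this.trans ?_
  rw [norm_div, div_pow, div_eq_mul_inv, ← mul_assoc]
  gcongr

lemma WE_diff (lam : ℝ) (p : ℤ × ℤ) : Differentiable ℂ (WE lam p) := by
  unfold WE; fun_prop

lemma WE_mult {lam : ℝ} (hlam : 0 < lam) (R : ℝ) (hR : 0 < R) :
    MultipliableLocallyUniformlyOn (WE lam) (Metric.ball (0 : ℂ) R) := by
  have := Summable.multipliableLocallyUniformlyOn_one_add (f := fun p z => WE lam p z - 1)
    Metric.isOpen_ball ((LP_summable hlam).mul_left (4 * R ^ 3)) (WE_bound hlam R hR)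
    (fun p => ((WE_diff lam p).continuous.sub continuous_const).continuousOn)
  simpa using this

lemma WG_diff {lam : ℝ} (hlam : 0 < lam) : Differentiable ℂ (WG lam) := by
  intro z
  have hR : 0 < ‖z‖ + 1 := by positivity
  have h := (WE_mult hlam _ hR).hasProdLocallyUniformlyOn
  have h2 : DifferentiableOn ℂ (WG lam) (Metric.ball (0 : ℂ) (‖z‖ + 1)) := by
    refine TendstoLocallyUniformlyOn.differentiableOn (φ := Filter.atTop) h
      (Filter.Eventually.of_forall fun s => ?_) Metric.isOpen_ball
    have := fun p : ℤ × ℤ => WE_diff lam p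
    fun_prop
  exact h2.differentiableAt (Metric.isOpen_ball.mem_nhds (by simp))

lemma WE_ne {lam : ℝ} (hlam : 0 < lam) {z : ℂ} (hz : ∀ p : ℤ × ℤ, p ≠ 0 → z ≠ LP lam p)
    (p : ℤ × ℤ) : WE lam p z ≠ 0 := by
  by_cases hp : p = 0
  · subst hp; rw [WE_zero]; exact one_ne_zero
  · unfold WE
    refine mul_ne_zero ?_ (Complex.exp_ne_zero _)
    rw [sub_ne_zero, ne_eq, eq_comm, div_eq_one_iff_eq (LP_ne hlam hp)]
    exact hz p hp

lemma WG_ne {lam : ℝ} (hlam : 0 < lam) {z : ℂ} (hz : ∀ p : ℤ × ℤ, p ≠ 0 → z ≠ LP lam p) :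
    WG lam z ≠ 0 := by
  have h := tprod_one_add_ne_zero_of_summable (f := fun p => WE lam p z - 1)
    (by intro p; simpa using WE_ne hlam hz p) (by
      have hR : 0 < ‖z‖ + 1 := by positivity
      refine Summable.of_norm_bounded_eventually
        ((LP_summable hlam).mul_left (4 * (‖z‖ + 1) ^ 3)) ?_
      filter_upwards [WE_bound hlam _ hR] with p hp
      simpa using hp z (by simp))
  simpa [WG] using h

/-- Term of the partial fraction series for the zeta function. -/
noncomputable def ZT (lam : ℝ) (z : ℂ) (p : ℤ × ℤ) : ℂ :=
  (z - LP lam p)⁻¹ + (LP lam p)⁻¹ + z / LP lam p ^ 2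

lemma ZT_summable {lam : ℝ} (hlam : 0 < lam) (z : ℂ) : Summable (ZT lam z) := by
  refine Summable.of_norm_bounded_eventually
    ((LP_summable hlam).mul_left (2 * ‖z‖ ^ 2)) ?_
  filter_upwards [LP_large hlam (2 * (‖z‖ + 1)) (by positivity)] with p hp
  have hpos : 0 < ‖LP lam p‖ := by linarith [norm_nonneg z]
  have h0 : LP lam p ≠ 0 := norm_pos_iff.1 hpos
  have h1 : ‖LP lam p‖ / 2 ≤ ‖z - LP lam p‖ := by
    have := norm_sub_norm_le (LP lam p) z
    rw [norm_sub_rev] at this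
    linarith [norm_nonneg z]
  have h2 : z - LP lam p ≠ 0 := norm_pos_iff.1 (by linarith)
  have e : ZT lam z p = z ^ 2 / (LP lam p ^ 2 * (z - LP lam p)) := by
    unfold ZT; field_simp; ring
  rw [e, norm_div, norm_mul, norm_pow, norm_pow, div_le_iff₀ (by positivity)]
  calc ‖z‖ ^ 2 = 2 * ‖z‖ ^ 2 * (‖LP lam p‖ ^ 3)⁻¹ * (‖LP lam p‖ ^ 2 * (‖LP lam p‖ / 2)) := by
        field_simp
    _ ≤ _ := by gcongr

lemma logDeriv_WE {lam : ℝ} (hlam : 0 < lam) {z : ℂ} {p : ℤ × ℤ} (hp : p ≠ 0)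
    (hz : z ≠ LP lam p) : logDeriv (WE lam p) z = ZT lam z p := by
  have h0 := LP_ne hlam hp
  have hs : z - LP lam p ≠ 0 := sub_ne_zero.2 hz
  have hs' : LP lam p - z ≠ 0 := sub_ne_zero.2 hz.symm
  have h1 : 1 - z / LP lam p ≠ 0 := by
    rw [sub_ne_zero, ne_eq, eq_comm, div_eq_one_iff_eq h0]; exact hz
  have hd : HasDerivAt (WE lam p)
      ((-(1 / LP lam p)) * Complex.exp (z / LP lam p + z ^ 2 / (2 * LP lam p ^ 2)) +
      (1 - z / LP lam p) * (Complex.exp (z / LP lam p + z ^ 2 / (2 * LP lam p ^ 2)) *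
        (1 / LP lam p + (2 * z) / (2 * LP lam p ^ 2)))) z := by
    have a : HasDerivAt (fun z : ℂ => 1 - z / LP lam p) (-(1 / LP lam p)) z :=
      ((hasDerivAt_id z).div_const _).const_sub 1
    have b : HasDerivAt (fun z : ℂ => z / LP lam p + z ^ 2 / (2 * LP lam p ^ 2))
        (1 / LP lam p + (2 * z) / (2 * LP lam p ^ 2)) z := by
      have := ((hasDerivAt_id z).div_const (LP lam p)).add
        ((hasDerivAt_pow 2 z).div_const (2 * LP lam p ^ 2))
      convert! this using 1
      simp
    exact a.mul b.cexp
  rw [logDeriv_apply, hd.deriv]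
  unfold WE ZT
  have he := Complex.exp_ne_zero (z / LP lam p + z ^ 2 / (2 * LP lam p ^ 2))
  rw [div_eq_iff (mul_ne_zero h1 he)]
  generalize Complex.exp (z / LP lam p + z ^ 2 / (2 * LP lam p ^ 2)) = E
  field_simp
  ring

lemma wsigma_deriv {lam : ℝ} (hlam : 0 < lam) (z : ℂ) :
    deriv (wsigma lam) z = WG lam z + z * deriv (WG lam) z := by
  have : wsigma lam = fun z => z * WG lam z := funext (wsigma_eq hlam)
  rw [this]
  have := (hasDerivAt_id z).mul (WG_diff hlam z).hasDerivAt
  simpa using! this.deriv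

lemma wzetaW_eq {lam : ℝ} (hlam : 0 < lam) {z : ℂ} (h0 : z ≠ 0) (hG : WG lam z ≠ 0) :
    wzetaW lam z = z⁻¹ + deriv (WG lam) z / WG lam z := by
  unfold wzetaW
  rw [wsigma_deriv hlam, wsigma_eq hlam]
  field_simp

lemma ZT_zero (lam : ℝ) (z : ℂ) : ZT lam z 0 = z⁻¹ := by simp [ZT, LP_zero]

lemma wzetaW_tsum {lam : ℝ} (hlam : 0 < lam) {z : ℂ} (hz : ∀ p : ℤ × ℤ, z ≠ LP lam p) :
    wzetaW lam z = ∑' p, ZT lam z p := by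
  have h0 : z ≠ 0 := by simpa [LP_zero] using hz 0
  have hG := WG_ne hlam (fun p _ => hz p)
  rw [wzetaW_eq hlam h0 hG, (ZT_summable hlam z).tsum_eq_add_tsum_ite 0, ZT_zero]
  congr 1
  have e : ∀ p, logDeriv (WE lam p) z = ite (p = 0) 0 (ZT lam z p) := by
    intro p
    split_ifs with hp
    · subst hp
      have : WE lam 0 = fun _ => 1 := funext (WE_zero lam)
      rw [this]; simp
    · exact logDeriv_WE hlam hp (hz p)
  have hs : Summable fun p => logDeriv (WE lam p) z := by
    simp_rw [e]
    refine (ZT_summable hlam z).norm.of_norm_bounded (fun p => ?_)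
    split_ifs <;> simp
  have hR : 0 < ‖z‖ + 1 := by positivity
  have := logDeriv_tprod_eq_tsum (x := z) Metric.isOpen_ball
    (show z ∈ Metric.ball (0 : ℂ) (‖z‖ + 1) by simp)
    (WE_ne hlam (fun p _ => hz p)) (fun p => (WE_diff lam p).differentiableOn) hs
    (WE_mult hlam _ hR) hG
  simp_rw [e] at this
  rw [← this]
  rfl

lemma WG_even (lam : ℝ) (z : ℂ) : WG lam (-z) = WG lam z := by
  unfold WG
  rw [← (Equiv.neg (ℤ × ℤ)).tprod_eq]
  refine tprod_congr fun p => ?_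
  have : LP lam (-p) = -LP lam p := by simp [LP]; ring
  simp only [Equiv.neg_apply, WE, this, neg_div_neg_eq, neg_sq]

lemma WG_deriv_zero (lam : ℝ) : deriv (WG lam) 0 = 0 := by
  have h := deriv_comp_neg (WG lam) 0
  simp_rw [WG_even] at h
  rw [neg_zero] at h
  exact self_eq_neg.1 h

lemma imag_ne (lam : ℝ) {t : ℝ} (ht : ∀ n : ℤ, t ≠ 2 * n) (p : ℤ × ℤ) :
    (t : ℂ) * Complex.I ≠ LP lam p := by
  intro h
  have := congrArg Complex.im h
  rw [LP_im] at this
  apply ht p.2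
  simpa using this

lemma not_even_of {t : ℝ} (h0 : 0 < t) (h2 : t < 2) (n : ℤ) : t ≠ 2 * n := by
  rintro rfl
  have h3 : (0 : ℝ) < n := by linarith
  have h4 : (n : ℝ) < 1 := by linarith
  norm_cast at h3 h4
  omega

/-- Rescaled cotangent. -/
noncomputable def AC (a : ℂ) : ℂ :=
  (Real.pi : ℂ) / (2 * Complex.I) * Complex.cot (Real.pi * (a / (2 * Complex.I)))

lemma AC_zero : AC 0 = 0 := by simp [AC, Complex.cot]

lemma cot_neg' (z : ℂ) : Complex.cot (-z) = -Complex.cot z := by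
  simp [Complex.cot, div_neg]

lemma AC_neg (a : ℂ) : AC (-a) = -AC a := by
  unfold AC
  rw [neg_div, mul_neg, cot_neg', mul_neg]

lemma AC_hasSum {a : ℂ} (ha : a = 0 ∨ ∀ n : ℤ, a ≠ 2 * n * Complex.I) :
    HasSum (fun n : ℕ => (a - 2 * n * Complex.I)⁻¹ + (a + 2 * n * Complex.I)⁻¹) (AC a + a⁻¹) := by
  rcases ha with rfl | ha
  · have : (fun n : ℕ => ((0 : ℂ) - 2 * n * Complex.I)⁻¹ + (0 + 2 * n * Complex.I)⁻¹) =
        fun _ => 0 := by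
      funext n; rw [zero_sub, zero_add, inv_neg]; ring
    rw [this, AC_zero]; simp
  · set x := a / (2 * Complex.I) with hxdef
    have hI := Complex.I_ne_zero
    have hax : a = 2 * Complex.I * x := by rw [hxdef]; field_simp
    have hx : x ∈ Complex.integerComplement := by
      rintro ⟨n, hn⟩
      apply ha n
      rw [hax, ← hn]; ring
    have h1 := (summable_cotTerm hx).hasSum
    have h2 : ∑' n, cotTerm x n = Real.pi * Complex.cot (Real.pi * x) - 1 / x :=
      (cot_series_rep' hx).symm
    rw [h2] at h1
    have h3 := h1.mul_left (2 * Complex.I)⁻¹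
    rw [← hasSum_nat_add_iff' 1]
    convert! h3 using 1
    · funext n
      unfold cotTerm
      rw [hax]
      push_cast
      rw [one_div, one_div, mul_add (2 * Complex.I)⁻¹, ← mul_inv, ← mul_inv]
      congr 2 <;> ring
    · have hx0 : x ≠ 0 := by
        intro h
        exact hx ⟨0, by simp [h]⟩
      simp only [Finset.range_one, Finset.sum_singleton, Nat.cast_zero, mul_zero, zero_mul,
        sub_zero, add_zero]
      unfold AC
      rw [← hxdef, hax]
      field_simp
      ring

/-- Row value. -/
noncomputable def RV (lam β : ℝ) (m : ℤ) : ℂ :=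
  AC (2 * β * Complex.I - 2 * lam * m) - AC (-(2 * lam * m)) -
    2 * β * (AC (Complex.I - 2 * lam * m) - AC (-(2 * lam * m)))

/-- Combined term. -/
noncomputable def DT (lam β : ℝ) (p : ℤ × ℤ) : ℂ :=
  ZT lam (2 * β * Complex.I) p - 2 * β * ZT lam Complex.I p

lemma DT_eq (lam β : ℝ) (m n : ℤ) : DT lam β (m, n) =
    ((2 * β * Complex.I - 2 * lam * m) - 2 * n * Complex.I)⁻¹
      - (-(2 * lam * m) - 2 * n * Complex.I)⁻¹
      - 2 * β * (((Complex.I - 2 * lam * m) - 2 * n * Complex.I)⁻¹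
      - (-(2 * lam * m) - 2 * n * Complex.I)⁻¹) := by
  unfold DT ZT LP
  have h1 : (-(2 * lam * m) - 2 * n * Complex.I : ℂ)⁻¹ =
    -(2 * lam * m + 2 * n * Complex.I : ℂ)⁻¹ := by rw [← inv_neg]; ring
  simp only [h1, sub_sub]
  ring

lemma DT_summable {lam : ℝ} (hlam : 0 < lam) (β : ℝ) : Summable (DT lam β) :=
  (ZT_summable hlam _).sub ((ZT_summable hlam _).mul_left _)

lemma shift_ne {lam t : ℝ} (ht : ∀ n : ℤ, t ≠ 2 * n) (m n : ℤ) :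
    (t * Complex.I - 2 * lam * m : ℂ) ≠ 2 * n * Complex.I := by
  intro h
  have := congrArg Complex.im h
  apply ht n
  simpa using this

lemma row_sum {lam β : ℝ} (hlam : 0 < lam) (hβ : β ∈ Ioo (0 : ℝ) 1) (m : ℤ) :
    ∑' n : ℤ, DT lam β (m, n) = RV lam β m := by
  have hs : Summable fun n : ℤ => DT lam β (m, n) := (DT_summable hlam β).prod_factor m
  have h1 := hs.hasSum.nat_add_neg
  have a1 : ∀ n : ℤ, (2 * β * Complex.I - 2 * lam * m : ℂ) ≠ 2 * n * Complex.I := by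
    have := fun n => shift_ne (lam := lam)
      (not_even_of (t := 2 * β) (by linarith [hβ.1]) (by linarith [hβ.2])) m n
    simpa using this
  have a2 : ∀ n : ℤ, (Complex.I - 2 * lam * m : ℂ) ≠ 2 * n * Complex.I := by
    have := fun n => shift_ne (lam := lam) (not_even_of (t := 1) (by norm_num) (by norm_num)) m n
    simpa using this
  have a3 : (-(2 * lam * m) : ℂ) = 0 ∨ ∀ n : ℤ, (-(2 * lam * m) : ℂ) ≠ 2 * n * Complex.I := by
    by_cases hm : m = 0
    · left; simp [hm]
    · right
      intro n h
      have := congrArg Complex.re h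
      simp [hlam.ne', hm] at this
  have b1 := AC_hasSum (Or.inr a1)
  have b2 := AC_hasSum (Or.inr a2)
  have b3 := AC_hasSum a3
  have b4 := (b1.sub b3).sub ((b2.sub b3).mul_left (2 * (β : ℂ)))
  have h2 : HasSum (fun n : ℕ => DT lam β (m, (n : ℤ)) + DT lam β (m, -(n : ℤ)))
      (RV lam β m + DT lam β (m, 0)) := by
    convert! b4 using 1
    · funext n
      rw [DT_eq, DT_eq]
      push_cast
      simp only [mul_neg, neg_mul, sub_neg_eq_add]
      ring
    · rw [DT_eq]
      unfold RV
      simp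
      ring
  have := h1.unique h2
  exact add_right_cancel this

lemma AC_I (lam : ℝ) (m : ℤ) : AC (Complex.I - 2 * lam * m) + AC (Complex.I + 2 * lam * m) = 0 := by
  unfold AC
  have hI := Complex.I_ne_zero
  have e1 : (Real.pi * ((Complex.I - 2 * lam * m) / (2 * Complex.I)) : ℂ) =
      Real.pi / 2 - (Real.pi * lam * m / Complex.I) := by field_simp
  have e2 : (Real.pi * ((Complex.I + 2 * lam * m) / (2 * Complex.I)) : ℂ) =
      Real.pi / 2 - (-(Real.pi * lam * m / Complex.I)) := by field_simp; ring
  rw [e1, e2]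
  simp only [Complex.cot, Complex.sin_pi_div_two_sub, Complex.cos_pi_div_two_sub,
    Complex.sin_neg, Complex.cos_neg]
  ring

lemma RV_pair (lam β : ℝ) (m : ℤ) : RV lam β m + RV lam β (-m) =
    AC (2 * β * Complex.I - 2 * lam * m) + AC (2 * β * Complex.I + 2 * lam * m) := by
  unfold RV
  push_cast
  simp only [mul_neg, neg_neg, sub_neg_eq_add, AC_neg]
  linear_combination (-2 * (β : ℂ)) * AC_I lam m

/-- Double series term. -/
noncomputable def FT (lam β : ℝ) (m k : ℕ) : ℝ :=
  Real.exp (-(2 * Real.pi * lam)) ^ ((m + 1) * (k + 1)) * Real.sin (2 * (k + 1) * Real.pi * β)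

lemma FT_summable {lam : ℝ} (hlam : 0 < lam) (β : ℝ) :
    Summable fun p : ℕ × ℕ => FT lam β p.1 p.2 := by
  set r := Real.exp (-(2 * Real.pi * lam)) with hr
  have hr0 : 0 ≤ r := (Real.exp_pos _).le
  have hr1 : r < 1 := by
    rw [hr, Real.exp_lt_one_iff]; have := Real.pi_pos; simp; positivity
  have hg := summable_geometric_of_lt_one hr0 hr1
  have h2 := hg.mul_of_nonneg hg (fun n => by positivity) (fun n => by positivity)
  refine h2.of_norm_bounded (fun p => ?_)
  unfold FT
  rw [← hr, norm_mul, Real.norm_eq_abs, Real.norm_eq_abs, abs_of_nonneg (by positivity)]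
  calc r ^ ((p.1 + 1) * (p.2 + 1)) * |Real.sin (2 * (p.2 + 1) * Real.pi * β)|
      ≤ r ^ ((p.1 + 1) * (p.2 + 1)) * 1 := by gcongr; exact Real.abs_sin_le_one _
    _ ≤ r ^ (p.1 + p.2) := by
        rw [mul_one]; exact pow_le_pow_of_le_one hr0 hr1.le (by nlinarith)
    _ = _ := pow_add _ _ _

lemma FT_col {lam : ℝ} (hlam : 0 < lam) (β : ℝ) (k : ℕ) :
    ∑' m, FT lam β m k = Real.sin (2 * (k + 1) * Real.pi * β) /
          (Real.exp (2 * (k + 1) * Real.pi * lam) - 1) := by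
  unfold FT
  rw [tsum_mul_right]
  set r := Real.exp (-(2 * Real.pi * lam)) with hr
  have hr0 : 0 < r := Real.exp_pos _
  have hr1 : r < 1 := by
    rw [hr, Real.exp_lt_one_iff]; have := Real.pi_pos; simp; positivity
  have hk1 : r ^ (k + 1) < 1 := pow_lt_one₀ hr0.le hr1 (by omega)
  have e : ∀ m : ℕ, r ^ ((m + 1) * (k + 1)) = r ^ (k + 1) * (r ^ (k + 1)) ^ m := by
    intro m; rw [← pow_mul, ← pow_add]; ring_nf
  simp_rw [e]
  rw [tsum_mul_left, tsum_geometric_of_lt_one (by positivity) hk1]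
  have e2 : Real.exp (2 * (k + 1) * Real.pi * lam) = (r ^ (k + 1))⁻¹ := by
    rw [hr, ← Real.exp_nat_mul, ← Real.exp_neg]; push_cast; ring_nf
  rw [e2]
  have : r ^ (k + 1) ≠ 0 := by positivity
  have h3 : 1 - r ^ (k + 1) ≠ 0 := by linarith
  have h4 : (r ^ (k + 1))⁻¹ - 1 ≠ 0 := by
    have := (one_lt_inv₀ (by positivity : 0 < r ^ (k + 1))).2 hk1
    linarith
  field_simp

lemma FT_row {lam : ℝ} (hlam : 0 < lam) (β : ℝ) (m : ℕ) :
    AC (2 * β * Complex.I - 2 * lam * ((m + 1 : ℕ) : ℤ)) +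
      AC (2 * β * Complex.I + 2 * lam * ((m + 1 : ℕ) : ℤ)) =
    (Real.pi : ℂ) / (2 * Complex.I) * (4 * ((∑' k, FT lam β m k : ℝ) : ℂ)) := by
  have hI := Complex.I_ne_zero
  have hpi : (Real.pi : ℂ) ≠ 0 := by exact_mod_cast Real.pi_ne_zero
  have hpos : 0 < lam * (m + 1) := by positivity
  let x1 : UpperHalfPlane := ⟨β + (lam * (m + 1) : ℝ) * Complex.I, by simpa using hpos⟩
  let x2 : UpperHalfPlane := ⟨-β + (lam * (m + 1) : ℝ) * Complex.I, by simpa using hpos⟩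
  have c1 : (x1 : ℂ) = β + (lam * (m + 1) : ℝ) * Complex.I := rfl
  have c2 : (x2 : ℂ) = -β + (lam * (m + 1) : ℝ) * Complex.I := rfl
  have q1 := pi_mul_cot_pi_q_exp x1
  have q2 := pi_mul_cot_pi_q_exp x2
  have s1 := (summable_geometric_of_norm_lt_one (UpperHalfPlane.norm_exp_two_pi_I_lt_one x1))
  have s2 := (summable_geometric_of_norm_lt_one (UpperHalfPlane.norm_exp_two_pi_I_lt_one x2))
  have s3 := s1.sub s2
  have e1 : (2 * β * Complex.I - 2 * lam * ((m + 1 : ℕ) : ℤ)) / (2 * Complex.I) = (x1 : ℂ) := by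
    rw [c1]; push_cast
    field_simp
    linear_combination (-(lam : ℂ) * (m + 1)) * Complex.I_sq
  have e2 : (2 * β * Complex.I + 2 * lam * ((m + 1 : ℕ) : ℤ)) / (2 * Complex.I) = -(x2 : ℂ) := by
    rw [c2]; push_cast
    field_simp
    linear_combination ((lam : ℂ) * (m + 1)) * Complex.I_sq
  unfold AC
  rw [e1, e2, mul_neg, cot_neg', ← mul_add]
  congr 1
  have hsub : ∑' n : ℕ, (Complex.exp (2 * Real.pi * Complex.I * x1) ^ n -
      Complex.exp (2 * Real.pi * Complex.I * x2) ^ n) =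
      2 * Complex.I * ((∑' k, FT lam β m k : ℝ) : ℂ) := by
    rw [s3.tsum_eq_zero_add, pow_zero, pow_zero, sub_self, zero_add, Complex.ofReal_tsum,
      ← tsum_mul_left]
    refine tsum_congr fun k => ?_
    unfold FT
    rw [← Complex.exp_nat_mul, ← Complex.exp_nat_mul, c1, c2]
    push_cast
    rw [← Complex.exp_nat_mul, Complex.sin]
    have t1 : Complex.exp (((k : ℂ) + 1) * (2 * Real.pi * Complex.I *
        (β + lam * (m + 1) * Complex.I))) =
        Complex.exp (((((m + 1) * (k + 1) : ℕ)) : ℂ) * (-(2 * Real.pi * lam))) *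
        Complex.exp (2 * (k + 1) * Real.pi * β * Complex.I) := by
      rw [← Complex.exp_add]; congr 1; push_cast
      linear_combination (2 * Real.pi * lam * (m + 1) * (k + 1) : ℂ) * Complex.I_sq
    have t2 : Complex.exp (((k : ℂ) + 1) * (2 * Real.pi * Complex.I *
        (-β + lam * (m + 1) * Complex.I))) =
        Complex.exp (((((m + 1) * (k + 1) : ℕ)) : ℂ) * (-(2 * Real.pi * lam))) *
        Complex.exp (-(2 * (k + 1) * Real.pi * β) * Complex.I) := by
      rw [← Complex.exp_add]; congr 1; push_cast
      linear_combination (2 * Real.pi * lam * (m + 1) * (k + 1) : ℂ) * Complex.I_sq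
    rw [t1, t2]
    linear_combination (-Complex.exp (((((m + 1) * (k + 1) : ℕ)) : ℂ) * (-(2 * Real.pi * lam))) *
      (Complex.exp (-(2 * (k + 1) * Real.pi * β) * Complex.I) -
        Complex.exp (2 * (k + 1) * Real.pi * β * Complex.I))) * Complex.I_sq
  rw [s1.tsum_sub s2] at hsub
  apply mul_left_cancel₀ hpi
  linear_combination q1 - q2 - 2 * Real.pi * Complex.I * hsub -
    4 * Real.pi * ((∑' k, FT lam β m k : ℝ) : ℂ) * Complex.I_sq

lemma DT_total {lam β : ℝ} (hlam : 0 < lam) (hβ : β ∈ Ioo (0 : ℝ) 1) :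
    ∑' p, DT lam β p = (Real.pi : ℂ) / (2 * Complex.I) *
      (Complex.cot (Real.pi * β) + 4 * ((∑' k : ℕ, Real.sin (2 * (k + 1) * Real.pi * β) /
          (Real.exp (2 * (k + 1) * Real.pi * lam) - 1) : ℝ) : ℂ)) := by
  have hI := Complex.I_ne_zero
  have hs := DT_summable hlam β
  rw [hs.tsum_prod]
  have hs2 : Summable fun m : ℤ => ∑' n : ℤ, DT lam β (m, n) := hs.prod
  simp_rw [row_sum hlam hβ] at hs2 ⊢
  have h1 := hs2.hasSum.nat_add_neg
  rw [← hasSum_nat_add_iff' 1] at h1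
  have hS := FT_summable hlam β
  have h2 : ∑' n : ℕ, (RV lam β ((n + 1 : ℕ) : ℤ) + RV lam β (-((n + 1 : ℕ) : ℤ))) =
      (Real.pi : ℂ) / (2 * Complex.I) *
      (4 * ((∑' k : ℕ, Real.sin (2 * (k + 1) * Real.pi * β) /
          (Real.exp (2 * (k + 1) * Real.pi * lam) - 1) : ℝ) : ℂ)) := by
    simp_rw [RV_pair, FT_row hlam]
    rw [tsum_mul_left, tsum_mul_left, ← Complex.ofReal_tsum]
    congr 3
    rw [← Summable.tsum_comm (f := fun m k => FT lam β m k) hS]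
    exact tsum_congr fun k => FT_col hlam β k
  have h3 := h1.tsum_eq
  rw [h2] at h3
  have h0 : RV lam β 0 = (Real.pi : ℂ) / (2 * Complex.I) * Complex.cot (Real.pi * β) := by
    have hAI : AC Complex.I = 0 := by
      have := AC_I lam 0
      simp only [Int.cast_zero, mul_zero, sub_zero, add_zero] at this
      exact self_eq_neg.1 (by linear_combination this)
    unfold RV
    simp only [Int.cast_zero, mul_zero, sub_zero, neg_zero, AC_zero, hAI]
    unfold AC
    congr 3
    field_simp
  simp only [Finset.range_one, Finset.sum_singleton, Nat.cast_zero, neg_zero] at h3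
  linear_combination h0 - h3

theorem statement14 (lam γ β : ℝ) (hlam : 0 < lam) (hβ : β ∈ Ioo (0 : ℝ) 1) :
    (∃ (U : Set ℂ) (h : ℂ → ℂ), IsOpen U ∧ Complex.I * β ∈ U ∧
      DifferentiableOn ℂ h U ∧
      (∀ z ∈ U \ {Complex.I * (β : ℂ)},
        h z = WzP lam γ β z - (γ : ℂ) / (2 * (Real.pi : ℂ) * Complex.I) *
          (z - Complex.I * β)⁻¹) ∧
      h (Complex.I * β) = 1 + (γ : ℂ) *
        (2 * (β : ℂ) * wzetaW lam Complex.I - wzetaW lam (2 * (β : ℂ) * Complex.I)) /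
          (2 * (Real.pi : ℂ) * Complex.I))
    ∧ (2 * (β : ℂ) * wzetaW lam Complex.I - wzetaW lam (2 * (β : ℂ) * Complex.I)) /
        (2 * (Real.pi : ℂ) * Complex.I) =
      (((1 / 4) * Real.cot (Real.pi * β) +
        ∑' k : ℕ, Real.sin (2 * (k + 1) * Real.pi * β) /
          (Real.exp (2 * (k + 1) * Real.pi * lam) - 1) : ℝ) : ℂ) := by
  have hI := Complex.I_ne_zero
  have hpi : (Real.pi : ℂ) ≠ 0 := by exact_mod_cast Real.pi_ne_zero
  have n1 : ∀ p, (2 * (β : ℂ) * Complex.I) ≠ LP lam p := by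
    have := imag_ne lam
      (not_even_of (t := 2 * β) (by linarith [hβ.1]) (by linarith [hβ.2]))
    simpa using this
  have n2 : ∀ p, Complex.I ≠ LP lam p := by
    have := imag_ne lam (not_even_of (t := 1) (by norm_num) (by norm_num))
    simpa using this
  have hGd := WG_diff hlam
  have hGd' : Differentiable ℂ (deriv (WG lam)) := fun z =>
    ((hGd.analyticAt z).deriv).differentiableAt
  have hsd : Differentiable ℂ (wsigma lam) := by
    have : wsigma lam = fun z => z * WG lam z := funext (wsigma_eq hlam)
    rw [this]; fun_prop
  have hsd' : Differentiable ℂ (deriv (wsigma lam)) := fun z =>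
    ((hsd.analyticAt z).deriv).differentiableAt
  constructor
  · refine ⟨{z | WG lam (z - Complex.I * β) ≠ 0 ∧ wsigma lam (z + Complex.I * β) ≠ 0},
      fun z => (γ : ℂ) / (2 * (Real.pi : ℂ) * Complex.I) *
        (deriv (WG lam) (z - Complex.I * β) / WG lam (z - Complex.I * β)
          - deriv (wsigma lam) (z + Complex.I * β) / wsigma lam (z + Complex.I * β)
          + 2 * (β : ℂ) * wzetaW lam Complex.I) + 1, ?_, ?_, ?_, ?_, ?_⟩
    · have hc1 := hGd.continuous
      have hc2 := hsd.continuous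
      exact (isOpen_ne_fun (by fun_prop) (by fun_prop)).inter
        (isOpen_ne_fun (by fun_prop) (by fun_prop))
    · refine ⟨?_, ?_⟩
      · rw [sub_self]
        exact WG_ne hlam fun p hp => (LP_ne hlam hp).symm
      · rw [show Complex.I * β + Complex.I * β = 2 * (β : ℂ) * Complex.I by ring, wsigma_eq hlam]
        exact mul_ne_zero (by simpa [LP_zero] using n1 0) (WG_ne hlam fun p _ => n1 p)
    · rintro z ⟨hz1, hz2⟩
      apply DifferentiableAt.differentiableWithinAt
      refine DifferentiableAt.add_const _ (DifferentiableAt.const_mul ?_ _)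
      refine DifferentiableAt.add_const _ (DifferentiableAt.sub ?_ ?_)
      · exact DifferentiableAt.div (by fun_prop) (by fun_prop) hz1
      · exact DifferentiableAt.div (by fun_prop) (by fun_prop) hz2
    · rintro z ⟨⟨hz1, hz2⟩, hz3⟩
      have hz4 : z - Complex.I * β ≠ 0 := sub_ne_zero.2 hz3
      unfold WzP
      rw [wzetaW_eq hlam hz4 hz1]
      simp only [wzetaW]
      ring
    · simp only [sub_self, WG_deriv_zero, zero_div, zero_sub]
      rw [show Complex.I * β + Complex.I * β = 2 * (β : ℂ) * Complex.I by ring]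
      unfold wzetaW
      ring
  · have hT := DT_total hlam hβ
    have e : ∑' p, DT lam β p = wzetaW lam (2 * (β : ℂ) * Complex.I) -
        2 * (β : ℂ) * wzetaW lam Complex.I := by
      rw [wzetaW_tsum hlam n1, wzetaW_tsum hlam n2, ← tsum_mul_left,
        ← (ZT_summable hlam _).tsum_sub ((ZT_summable hlam _).mul_left _)]
      rfl
    rw [e] at hT
    rw [div_eq_iff (by simp [hpi]), Complex.ofReal_add, Complex.ofReal_mul, Complex.ofReal_cot,
      Complex.ofReal_mul]
    generalize ((∑' k : ℕ, Real.sin (2 * (k + 1) * Real.pi * β) /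
          (Real.exp (2 * (k + 1) * Real.pi * lam) - 1) : ℝ) : ℂ) = S at hT ⊢
    have e3 : (Real.pi : ℂ) / (2 * Complex.I) = -(Real.pi * Complex.I / 2) := by
      field_simp
      linear_combination Complex.I_sq
    rw [e3] at hT
    push_cast
    linear_combination -hT
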